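/- Let R be a commutative ring, n a natural number, I = (x₁,…,xₙ) ⊆ R[x₁,…,xₙ] and J = (x₁,…,xₙ) ⊆ S = R[[x₁,…,xₙ]]. For every p ≥ 1, the ring homomorphism R[x₁,…,xₙ]/I^p → S/J^p induced by the canonical injection of the polynomial ring into the power series ring is an isomorphism (bijective). -/

import Mathlib

namespace MvPowerSeries

variable {σ R : Type*} [CommRing R]

theorem map_coeToMvPowerSeries_idealOfVars_pow (p : ℕ) :
    ((MvPolynomial.idealOfVars σ R) ^ p).map MvPolynomial.coeToMvPowerSeries.ringHom =
      Ideal.span (Set.range (X : σ → MvPowerSeries σ R)) ^ p := by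
  rw [Ideal.map_pow, MvPolynomial.idealOfVars, Ideal.map_span, ← Set.range_comp]
  congr 3
  ext1 i
  simp

variable [Finite σ]

theorem truncTotal_mem_pow_idealOfVars {p : ℕ} {f : MvPowerSeries σ R}
    (hf : f ∈ Ideal.span (Set.range (X : σ → MvPowerSeries σ R)) ^ p) :
    f.truncTotal p ∈ MvPolynomial.idealOfVars σ R ^ p := by
  rw [← map_coeToMvPowerSeries_idealOfVars_pow] at hf
  suffices h : Ideal.map MvPolynomial.coeToMvPowerSeries.ringHom
      (MvPolynomial.idealOfVars σ R ^ p) ≤ RingHom.ker (truncTotalAlgHom σ R p) from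
    Ideal.Quotient.eq_zero_iff_mem.mp (h hf)
  refine Ideal.map_le_iff_le_comap.mpr fun g hg ↦ ?_
  exact ((truncTotalAlgHom σ R p).commutes g).trans (Ideal.Quotient.eq_zero_iff_mem.mpr hg)

/-- A power series in finitely many variables without terms of degree less than `p` lies in
the `p`-th power of the ideal generated by the variables. -/
theorem mem_span_range_X_pow {p : ℕ} {f : MvPowerSeries σ R}
    (hf : ∀ e : σ →₀ ℕ, e.degree < p → coeff e f = 0) :
    f ∈ Ideal.span (Set.range (X : σ → MvPowerSeries σ R)) ^ p := by
  classical
  have := Fintype.ofFinite σ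
  induction p generalizing f with
  | zero => simp
  | succ p ih =>
    have hex (e : σ →₀ ℕ) : ∃ i : Option σ, e ≠ 0 → ∃ j, i = some j ∧ e j ≠ 0 := by
      by_cases he : e = 0
      · exact ⟨none, fun h ↦ absurd he h⟩
      · obtain ⟨j, hj⟩ := Finsupp.ne_iff.mp he
        exact ⟨some j, fun _ ↦ ⟨j, rfl, hj⟩⟩
    choose c hc using hex
    let g (i : σ) : MvPowerSeries σ R := fun d ↦
      if c (d + Finsupp.single i 1) = some i then coeff (d + Finsupp.single i 1) f else 0
    have hg (i : σ) (d : σ →₀ ℕ) : coeff d (g i) =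
      if c (d + Finsupp.single i 1) = some i then coeff (d + Finsupp.single i 1) f else 0 := rfl
    have hsum : f = ∑ i, X i * g i := by
      ext e
      rw [map_sum]
      by_cases he : e = 0
      · subst he
        simp [hf 0 (by simp), coeff_zero_X_mul]
      obtain ⟨j, hj, hej⟩ := hc e he
      rw [Finset.sum_eq_single j]
      · have hle : Finsupp.single j 1 ≤ e := by
          simpa [Finsupp.single_le_iff] using Nat.one_le_iff_ne_zero.mpr hej
        rw [X, coeff_monomial_mul, if_pos hle, one_mul, hg, tsub_add_cancel_of_le hle, if_pos hj]
      · intro i _ hij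
        rw [X, coeff_monomial_mul]
        split_ifs with hle
        · rw [hg, tsub_add_cancel_of_le hle, hj, if_neg (by simpa using hij.symm), mul_zero]
        · rfl
      · simp
    rw [hsum, pow_succ']
    refine Ideal.sum_mem _ fun i _ ↦ Ideal.mul_mem_mul (Ideal.subset_span ⟨i, rfl⟩) (ih ?_)
    intro d hd
    rw [hg, hf _ (by rw [map_add, Finsupp.degree_single]; lia), ite_self]

end MvPowerSeries

/-- For every `p ≥ 1`, the ring homomorphism
`R[x₁,…,xₙ]/I^p → R[[x₁,…,xₙ]]/J^p` induced by the canonical injection of the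
polynomial ring into the power series ring is bijective, where `I` and `J` are
the ideals generated by the variables in the respective rings. -/
theorem mvPolynomial_quotient_iso_mvPowerSeries_quotient (R : Type*) [CommRing R] (n : ℕ)
    (I : Ideal (MvPolynomial (Fin n) R))
    (hI : I = Ideal.span (Set.range (MvPolynomial.X : Fin n → MvPolynomial (Fin n) R)))
    (J : Ideal (MvPowerSeries (Fin n) R))
    (hJ : J = Ideal.span (Set.range (MvPowerSeries.X : Fin n → MvPowerSeries (Fin n) R)))
    (p : ℕ) (hp : 1 ≤ p)
    (hle : I ^ p ≤ (J ^ p).comap (MvPolynomial.coeToMvPowerSeries.ringHom :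
      MvPolynomial (Fin n) R →+* MvPowerSeries (Fin n) R)) :
    Function.Bijective
      (Ideal.quotientMap (J ^ p) MvPolynomial.coeToMvPowerSeries.ringHom hle) := by
  subst hI hJ
  refine ⟨(injective_iff_map_eq_zero _).mpr fun x hx ↦ ?_, fun y ↦ ?_⟩
  · obtain ⟨f, rfl⟩ := Ideal.Quotient.mk_surjective x
    rw [Ideal.quotientMap_mk, Ideal.Quotient.eq_zero_iff_mem] at hx
    rw [Ideal.Quotient.eq_zero_iff_mem]
    have h := (MvPolynomial.mem_pow_idealOfVars_iff' ..).mp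
      (MvPowerSeries.truncTotal_mem_pow_idealOfVars hx)
    refine (MvPolynomial.mem_pow_idealOfVars_iff' ..).mpr fun e he ↦ ?_
    simpa [MvPowerSeries.coeff_truncTotal _ he] using h e he
  · obtain ⟨f, rfl⟩ := Ideal.Quotient.mk_surjective y
    refine ⟨Ideal.Quotient.mk _ (f.truncTotal p), ?_⟩
    rw [Ideal.quotientMap_mk, Ideal.Quotient.eq]
    refine MvPowerSeries.mem_span_range_X_pow fun e he ↦ ?_
    simp [MvPowerSeries.coeff_truncTotal _ he]
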